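/- (Concentration/information bound from McDiarmid) Let X₁,…,Xₙ be independent with product law Pⁿ = P₁×⋯×Pₙ and let ψ: 𝒳ⁿ → ℝ satisfy the bounded-differences condition |ψ(x₁,…,x_k,…,xₙ) - ψ(x₁,…,x_k',…,xₙ)| ≤ d_k for all inputs and each k. Then for any product measure Qⁿ = Q₁×⋯×Qₙ, |E_{Pⁿ}[ψ] - E_{Qⁿ}[ψ]| ≤ (Σ_{k=1}^n d_k²)^{1/2} · (2 Σ_{k=1}^n R(Q_k||P_k))^{1/2}. -/

import Mathlib

open MeasureTheory ProbabilityTheory Real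

/-- Kullback-Leibler divergence R(Q||P) = ∫ log(dQ/dP) dQ (as a real number). -/
noncomputable def klDiv {α : Type*} [MeasurableSpace α] (Q P : Measure α) : ℝ :=
  ∫ x, Real.log ((Q.rnDeriv P x).toReal) ∂Q

lemma klDiv_nonneg_of_ac {α : Type*} [MeasurableSpace α] {Q P : Measure α}
    [IsProbabilityMeasure P] [IsProbabilityMeasure Q] (hac : Q ≪ P)
    (hKL : Integrable (llr Q P) Q) : 0 ≤ klDiv Q P := by
  change 0 ≤ ∫ x, llr Q P x ∂Q
  simpa using InformationTheory.integral_llr_add_sub_measure_univ_nonneg hac hKL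

/-- The easy half of the Donsker-Varadhan variational formula. -/
lemma integral_le_klDiv_add_log_integral_exp {α : Type*} [MeasurableSpace α] {Q P : Measure α}
    [IsProbabilityMeasure P] [IsProbabilityMeasure Q] (hac : Q ≪ P)
    (hKL : Integrable (llr Q P) Q) {f : α → ℝ} (hfQ : Integrable f Q)
    (hfP : Integrable (fun x ↦ exp (f x)) P) :
    ∫ x, f x ∂Q ≤ klDiv Q P + log (∫ x, exp (f x) ∂P) := by
  have := isProbabilityMeasure_tilted hfP
  have hnonneg := klDiv_nonneg_of_ac (hac.trans (absolutelyContinuous_tilted hfP))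
    (integrable_llr_tilted_right hac hfQ hKL hfP)
  have heq : klDiv Q (P.tilted f) = klDiv Q P - ∫ x, f x ∂Q + log (∫ x, exp (f x) ∂P) :=
    integral_llr_tilted_right hac hfQ hfP hKL
  linarith

/-- A form of Pinsker's inequality for functions of oscillation at most `d`. -/
lemma abs_integral_sub_integral_le_mul_sqrt_klDiv {α : Type*} [MeasurableSpace α]
    {Q P : Measure α} [IsProbabilityMeasure P] [IsProbabilityMeasure Q] (hac : Q ≪ P)
    (hKL : Integrable (llr Q P) Q) {f : α → ℝ} (hf : Measurable f) {d : ℝ}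
    (hosc : ∀ x y, |f x - f y| ≤ d) :
    |(∫ x, f x ∂P) - ∫ x, f x ∂Q| ≤ d * √(klDiv Q P / 2) := by
  obtain ⟨x₀⟩ := P.nonempty_of_neZero
  have hd : 0 ≤ d := (abs_nonneg _).trans (hosc x₀ x₀)
  have hbdd : BddBelow (Set.range f) :=
    ⟨f x₀ - d, by rintro _ ⟨x, rfl⟩; linarith [(abs_le.1 (hosc x₀ x)).2]⟩
  have hmem (x : α) : f x ∈ Set.Icc (⨅ y, f y) ((⨅ y, f y) + d) := by
    have : Nonempty α := ⟨x₀⟩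
    refine ⟨ciInf_le hbdd x, ?_⟩
    have : f x - d ≤ ⨅ y, f y := le_ciInf fun y ↦ by linarith [(abs_le.1 (hosc x y)).2]
    linarith
  have hint (μ : Measure α) [IsProbabilityMeasure μ] : Integrable f μ :=
    Integrable.of_mem_Icc _ _ hf.aemeasurable (ae_of_all _ hmem)
  have hsub := hasSubgaussianMGF_of_mem_Icc (μ := P) hf.aemeasurable (ae_of_all _ hmem)
  set m := ∫ x, f x ∂P with hm
  have hR := klDiv_nonneg_of_ac hac hKL
  have hquad (t : ℝ) :
      0 ≤ d ^ 2 / 8 * (t * t) + (m - ∫ x, f x ∂Q) * t + klDiv Q P := by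
    have hdv := integral_le_klDiv_add_log_integral_exp hac hKL
      (f := fun x ↦ t * (f x - m)) (((hint Q).sub (integrable_const m)).const_mul t)
      (hsub.integrable_exp_mul t)
    have hmgf : log (∫ x, exp (t * (f x - m)) ∂P) ≤ d ^ 2 * t ^ 2 / 8 := by
      have h := log_le_log (integral_exp_pos (hsub.integrable_exp_mul t)) (hsub.mgf_le t)
      rw [log_exp] at h
      refine h.trans_eq ?_
      simp only [add_sub_cancel_left, NNReal.coe_pow, NNReal.coe_div, coe_nnnorm, norm_eq_abs,
        NNReal.coe_ofNat, div_pow, sq_abs]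
      ring
    rw [integral_const_mul, integral_sub (hint Q) (integrable_const m)] at hdv
    simp only [integral_const, probReal_univ, one_smul] at hdv
    linarith
  have hdisc := discrim_le_zero hquad
  rw [discrim] at hdisc
  refine abs_le_of_sq_le_sq ?_ (by positivity)
  rw [mul_pow, sq_sqrt (by positivity)]
  linarith

lemma abs_integral_le_of_forall_abs_le {α : Type*} [MeasurableSpace α] {μ : Measure α}
    [IsProbabilityMeasure μ] {f : α → ℝ} {C : ℝ} (h : ∀ x, |f x| ≤ C) : |∫ x, f x ∂μ| ≤ C := by
  simpa using norm_integral_le_of_norm_le_const (μ := μ) (f := f) (ae_of_all _ h)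

lemma abs_sub_le_sum_of_bounded_differences {X : Type*} {n : ℕ} {ψ : (Fin n → X) → ℝ}
    {d : Fin n → ℝ} (hbd : ∀ (x : Fin n → X) (k : Fin n) (y : X),
      |ψ x - ψ (Function.update x k y)| ≤ d k) (x y : Fin n → X) :
    |ψ x - ψ y| ≤ ∑ k, d k := by
  have h (s : Finset (Fin n)) : |ψ x - ψ (s.piecewise y x)| ≤ ∑ k ∈ s, d k := by
    induction s using Finset.induction_on with
    | empty => simp
    | insert j s hj ih =>
      rw [Finset.piecewise_insert, Finset.sum_insert hj, add_comm]
      exact (abs_sub_le _ _ _).trans (add_le_add ih (hbd _ _ _))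
  simpa using h Finset.univ

lemma integral_pi_eq_integral_integral_cons {X : Type*} [MeasurableSpace X] {n : ℕ}
    (μ : Fin (n + 1) → Measure X) [∀ k, IsProbabilityMeasure (μ k)]
    {ψ : (Fin (n + 1) → X) → ℝ} (hψ : Measurable ψ) {C : ℝ} (hC : ∀ x, |ψ x| ≤ C) :
    ∫ x, ψ x ∂(Measure.pi μ) =
      ∫ x, ∫ y, ψ (Fin.cons x y) ∂(Measure.pi fun k : Fin n ↦ μ k.succ) ∂(μ 0) := by
  rw [← ((measurePreserving_piFinSuccAbove μ 0).symm).integral_comp']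
  simp only [Fin.succAbove_zero]
  rw [integral_prod]
  · simp [Fin.insertNthEquiv]
  · exact Integrable.of_bound
      (hψ.comp (MeasurableEquiv.measurable _)).aestronglyMeasurable C (ae_of_all _ fun _ ↦ hC _)

/-- Changing the factors of a product measure one at a time. -/
lemma abs_integral_pi_sub_integral_pi_le_sum {X : Type*} [MeasurableSpace X] {n : ℕ}
    (P Q : Fin n → Measure X)
    [∀ k, IsProbabilityMeasure (P k)] [∀ k, IsProbabilityMeasure (Q k)]
    (hac : ∀ k, Q k ≪ P k) (hKL : ∀ k, Integrable (llr (Q k) (P k)) (Q k))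
    {ψ : (Fin n → X) → ℝ} (hψ : Measurable ψ) {d : Fin n → ℝ}
    (hbd : ∀ (x : Fin n → X) (k : Fin n) (y : X),
      |ψ x - ψ (Function.update x k y)| ≤ d k) {C : ℝ} (hC : ∀ x, |ψ x| ≤ C) :
    |(∫ x, ψ x ∂(Measure.pi P)) - (∫ x, ψ x ∂(Measure.pi Q))| ≤
      ∑ k, d k * √(klDiv (Q k) (P k) / 2) := by
  induction n with
  | zero =>
    obtain rfl := Subsingleton.elim P Q
    simp
  | succ n ih =>
    rw [integral_pi_eq_integral_integral_cons P hψ hC,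
      integral_pi_eq_integral_integral_cons Q hψ hC, Fin.sum_univ_succ]
    have hcons : Measurable fun p : X × (Fin n → X) ↦ ψ (Fin.cons p.1 p.2) := by
      refine hψ.comp (measurable_pi_lambda _ fun i ↦ ?_)
      refine Fin.cases ?_ (fun j ↦ ?_) i
      · simpa using measurable_fst
      · simpa [Function.comp_def] using (measurable_pi_apply j).comp measurable_snd
    have hsec (x : X) : Measurable fun y : Fin n → X ↦ ψ (Fin.cons x y) :=
      hcons.comp measurable_prodMk_left
    have hsec_int (μ : Fin n → Measure X) [∀ k, IsProbabilityMeasure (μ k)] (x : X) :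
        Integrable (fun y ↦ ψ (Fin.cons x y)) (Measure.pi μ) :=
      Integrable.of_bound (hsec x).aestronglyMeasurable C (ae_of_all _ fun _ ↦ hC _)
    have hF_meas (μ : Fin n → Measure X) [∀ k, IsProbabilityMeasure (μ k)] :
        Measurable fun x ↦ ∫ y, ψ (Fin.cons x y) ∂(Measure.pi μ) :=
      hcons.stronglyMeasurable.integral_prod_right'.measurable
    have hF_int (μ : Fin n → Measure X) [∀ k, IsProbabilityMeasure (μ k)] :
        Integrable (fun x ↦ ∫ y, ψ (Fin.cons x y) ∂(Measure.pi μ)) (Q 0) := by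
      refine Integrable.of_bound (hF_meas μ).aestronglyMeasurable C (ae_of_all _ fun x ↦ ?_)
      exact abs_integral_le_of_forall_abs_le fun y ↦ hC _
    have hhead := abs_integral_sub_integral_le_mul_sqrt_klDiv (hac 0) (hKL 0)
      (hF_meas fun k ↦ P k.succ) (d := d 0) fun x x' ↦ by
        rw [← integral_sub (hsec_int _ x) (hsec_int _ x')]
        exact abs_integral_le_of_forall_abs_le fun y ↦ by simpa using hbd (Fin.cons x y) 0 x'
    refine (abs_sub_le _ (∫ x, ∫ y, ψ (Fin.cons x y) ∂(Measure.pi fun k : Fin n ↦ P k.succ)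
      ∂(Q 0)) _).trans (add_le_add hhead ?_)
    rw [← integral_sub (hF_int _) (hF_int _)]
    have htail (x : X) := ih (fun k ↦ P k.succ) (fun k ↦ Q k.succ) (fun k ↦ hac k.succ)
      (fun k ↦ hKL k.succ) (hsec x) (d := fun k ↦ d k.succ)
      (fun y k z ↦ by simpa using hbd (Fin.cons x y) k.succ z) (fun y ↦ hC _)
    exact abs_integral_le_of_forall_abs_le htail

/-- McDiarmid-based concentration/information bound for product measures. -/
theorem mcdiarmid_concentration_information_bound
    {X : Type*} [MeasurableSpace X] {n : ℕ}
    (P Q : Fin n → Measure X)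
    [∀ k, IsProbabilityMeasure (P k)] [∀ k, IsProbabilityMeasure (Q k)]
    (hac : ∀ k, Q k ≪ P k)
    (hKL : ∀ k, Integrable (fun x => Real.log (((Q k).rnDeriv (P k) x).toReal)) (Q k))
    (ψ : (Fin n → X) → ℝ) (hψ : Measurable ψ)
    (d : Fin n → ℝ)
    (hbd : ∀ (x : Fin n → X) (k : Fin n) (y : X),
      |ψ x - ψ (Function.update x k y)| ≤ d k) :
    |(∫ x, ψ x ∂(Measure.pi P)) - (∫ x, ψ x ∂(Measure.pi Q))| ≤
      Real.sqrt (∑ k, (d k)^2) * Real.sqrt (2 * ∑ k, klDiv (Q k) (P k)) := by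
  have : Nonempty (Fin n → X) := (Measure.pi P).nonempty_of_neZero
  obtain ⟨x₀⟩ := this
  have hC (x : Fin n → X) : |ψ x| ≤ |ψ x₀| + ∑ k, d k := by
    have h := abs_sub_le_sum_of_bounded_differences hbd x x₀
    linarith [abs_sub_abs_le_abs_sub (ψ x) (ψ x₀)]
  have hR (k : Fin n) : 0 ≤ klDiv (Q k) (P k) := klDiv_nonneg_of_ac (hac k) (hKL k)
  refine (abs_integral_pi_sub_integral_pi_le_sum P Q hac hKL hψ hbd hC).trans ?_
  refine (Real.sum_mul_le_sqrt_mul_sqrt _ _ _).trans ?_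
  gcongr
  rw [Finset.mul_sum]
  refine Finset.sum_le_sum fun k _ ↦ ?_
  rw [sq_sqrt (by linarith [hR k])]
  linarith [hR k]
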